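/- Fix η > 0 and τ ∈ (0,1), and let δ = (η²τ² − τ² − 1)/4. Let (α,β) : ℝ → ℝ² be a solution of the system α'' = δα − 2α²β, β'' = δβ − 2αβ² with initial conditions α(0) = 0, β(0) = 2, α'(0) = ητ²/8 and β'(0) = (η²τ² + η² − 1)/(2η). Then there exist (necessarily unique) real numbers x_a⁻ < x_b⁻ < 0 < x_b⁺ < x_a⁺ such that: (i) α(x_a⁻) = α(x_a⁺) = 0; (ii) α < 0 on (x_a⁻, 0) and α > 0 on (0, x_a⁺); (iii) β(x_b⁻) = β(x_b⁺) = 0; (iv) β < 0 on (x_a⁻, x_b⁻) ∪ (x_b⁺, x_a⁺) and β > 0 on (x_b⁻, x_b⁺). If instead τ = 1 (with the same formulas for δ and the initial data), then α(x) < 0 for all x < 0 and α(x) > 0 for all x > 0, and β has exactly one zero x_b⁺, which is positive, with β > 0 on (−∞, x_b⁺) and β < 0 on (x_b⁺, ∞). -/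

import Mathlib

open Set

section Preliminaries

lemma pos_of_ne_zero_of_isPreconnected {f : ℝ → ℝ} {S : Set ℝ} (hS : IsPreconnected S)
    (hf : Continuous f) (hne : ∀ x ∈ S, f x ≠ 0) {a : ℝ} (ha : a ∈ S) (hfa : 0 < f a) :
    ∀ x ∈ S, 0 < f x := by
  intro x hx
  by_contra! h
  obtain ⟨z, hz, hz0⟩ := hS.intermediate_value hx ha hf.continuousOn ⟨h, hfa.le⟩
  exact hne z hz hz0

lemma neg_of_ne_zero_of_isPreconnected {f : ℝ → ℝ} {S : Set ℝ} (hS : IsPreconnected S)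
    (hf : Continuous f) (hne : ∀ x ∈ S, f x ≠ 0) {a : ℝ} (ha : a ∈ S) (hfa : f a < 0) :
    ∀ x ∈ S, f x < 0 := by
  intro x hx
  have := pos_of_ne_zero_of_isPreconnected hS hf.neg (fun y hy => neg_ne_zero.2 (hne y hy)) ha
    (neg_pos.2 hfa) x hx
  exact neg_pos.1 this

lemma eq_of_hasDerivAt_zero {f : ℝ → ℝ} (hf : ∀ x, HasDerivAt f 0 x) (x y : ℝ) : f x = f y :=
  is_const_of_deriv_eq_zero (fun z => (hf z).differentiableAt) (fun z => (hf z).deriv) x y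

lemma mul_sub_le_sub_of_hasDerivAt {f f' : ℝ → ℝ} {a b c : ℝ} (hf : ∀ x, HasDerivAt f (f' x) x)
    (hab : a ≤ b) (hc : ∀ x ∈ Ioo a b, c ≤ f' x) : c * (b - a) ≤ f b - f a := by
  refine (convex_Icc a b).mul_sub_le_image_sub_of_le_deriv
    (fun x _ => (hf x).continuousAt.continuousWithinAt)
    (fun x _ => (hf x).differentiableAt.differentiableWithinAt) (fun x hx => ?_)
    a (left_mem_Icc.2 hab) b (right_mem_Icc.2 hab) hab
  rw [interior_Icc] at hx
  rw [(hf x).deriv]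
  exact hc x hx

lemma surjective_of_le_hasDerivAt {f f' : ℝ → ℝ} {c : ℝ} (hc0 : 0 < c)
    (hf : ∀ x, HasDerivAt f (f' x) x) (hc : ∀ x, c ≤ f' x) : Function.Surjective f := by
  have hcont : Continuous f := continuous_iff_continuousAt.2 fun x => (hf x).continuousAt
  intro y
  set R := |y - f 0| / c with hR
  have hR0 : 0 ≤ R := by positivity
  have hcR : c * R = |y - f 0| := by rw [hR]; field_simp
  have h1 := mul_sub_le_sub_of_hasDerivAt hf hR0 (fun x _ => hc x)
  have h2 := mul_sub_le_sub_of_hasDerivAt hf (neg_nonpos.2 hR0) (fun x _ => hc x)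
  have h3 := le_abs_self (y - f 0)
  have h4 := neg_abs_le (y - f 0)
  exact mem_range_of_exists_le_of_exists_ge hcont ⟨-R, by linarith⟩ ⟨R, by linarith⟩

lemma sin_lt_sin_of_mem_Ioo {φ θ : ℝ} (h1 : φ < θ) (h2 : θ < Real.pi - φ)
    (hφ : -(Real.pi / 2) < φ) : Real.sin φ < Real.sin θ := by
  have h := Real.sin_sub_sin θ φ
  have hs : 0 < Real.sin ((θ - φ) / 2) :=
    Real.sin_pos_of_pos_of_lt_pi (by linarith) (by linarith)
  have hc : 0 < Real.cos ((θ + φ) / 2) :=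
    Real.cos_pos_of_mem_Ioo ⟨by linarith, by linarith⟩
  have : 0 < 2 * Real.sin ((θ - φ) / 2) * Real.cos ((θ + φ) / 2) := by positivity
  linarith

lemma sin_lt_sin_of_pi_sub_lt {φ θ : ℝ} (h1 : Real.pi - φ < θ) (h2 : θ < 2 * Real.pi + φ)
    (hφ : φ < Real.pi / 2) : Real.sin θ < Real.sin φ := by
  have h := sin_lt_sin_of_mem_Ioo (φ := -φ) (θ := θ - Real.pi) (by linarith) (by linarith)
    (by linarith)
  rw [Real.sin_sub_pi, Real.sin_neg] at h
  linarith

end Preliminaries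

section CubicOscillator

/-- If `4 (s + k) (s + b) (M - s)` is a square, then `s` cannot enter the gap `(-k, -b)`. -/
lemma neg_le_of_sq_eq_cubic {s p : ℝ → ℝ} {k b M : ℝ} (hM : 0 < M) (hb : 0 < b) (hbk : b < k)
    (hs : Continuous s) (hp2 : ∀ x, p x ^ 2 = 4 * (s x + k) * (s x + b) * (M - s x))
    (hs0 : s 0 = 0) (x : ℝ) : -b ≤ s x := by
  by_contra! hx
  obtain ⟨c, hc1, hc2⟩ := exists_between (max_lt hx (neg_lt_neg hbk))
  obtain ⟨hc3, hc4⟩ := max_lt_iff.1 hc1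
  obtain ⟨y, hy⟩ := mem_range_of_exists_le_of_exists_ge hs ⟨x, hc3.le⟩ ⟨0, by linarith⟩
  have h := hp2 y
  rw [hy] at h
  have : 0 < 4 * (c + k) * (-(c + b)) * (M - c) :=
    mul_pos (mul_pos (by linarith) (by linarith)) (by linarith)
  nlinarith [sq_nonneg (p y)]

/-- If `4 u² (c - u)` is the square of the derivative of `u`, then `u` does not reach zero from a
nonzero value. -/
lemma ne_zero_of_sq_eq {u p : ℝ → ℝ} {c : ℝ} (hu : ∀ x, HasDerivAt u (p x) x)
    (hp2 : ∀ x, p x ^ 2 = 4 * u x ^ 2 * (c - u x)) {a y : ℝ} (hay : a ≤ y) (ha : u a ≠ 0) :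
    u y ≠ 0 := by
  intro hy
  have hcont : Continuous u := continuous_iff_continuousAt.2 fun x => (hu x).continuousAt
  obtain ⟨B, hB⟩ := (isCompact_Icc (a := a) (b := y)).bddAbove_image
    (f := fun x => c - u x) (by fun_prop)
  have hB' : ∀ x ∈ Icc a y, c - u x ≤ B := fun x hx => hB (mem_image_of_mem _ hx)
  have hd : ∀ x, HasDerivAt (fun x => u x ^ 2 * Real.exp ((4 * |B| + 1) * x))
      ((2 * u x * p x + u x ^ 2 * (4 * |B| + 1)) * Real.exp ((4 * |B| + 1) * x)) x := by
    intro x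
    have h1 := ((hu x).pow 2).mul (((hasDerivAt_id x).const_mul (4 * |B| + 1)).exp)
    refine h1.congr_deriv ?_
    simp
    ring
  have h := mul_sub_le_sub_of_hasDerivAt (c := 0) hd hay (fun x hx => by
    have hx' := hB' x (Ioo_subset_Icc_self hx)
    refine mul_nonneg ?_ (Real.exp_pos _).le
    have h2 : p x ^ 2 ≤ 4 * u x ^ 2 * |B| := by
      rw [hp2]
      exact mul_le_mul_of_nonneg_left (hx'.trans (le_abs_self B)) (by positivity)
    nlinarith [sq_nonneg (u x + p x)])
  simp only [hy] at h
  have : 0 < u a ^ 2 * Real.exp ((4 * |B| + 1) * a) := by positivity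
  nlinarith

lemma ne_zero_of_sq_eq' {u p : ℝ → ℝ} {c : ℝ} (hu : ∀ x, HasDerivAt u (p x) x)
    (hp2 : ∀ x, p x ^ 2 = 4 * u x ^ 2 * (c - u x)) {a : ℝ} (ha : u a ≠ 0) (y : ℝ) :
    u y ≠ 0 := by
  rcases le_total a y with h | h
  · exact ne_zero_of_sq_eq hu hp2 h ha
  · have hu' : ∀ x, HasDerivAt (fun x => u (-x)) (-p (-x)) x := fun x => by
      exact ((hu (-x)).scomp x (hasDerivAt_neg x)).congr_deriv (by simp)
    simpa using ne_zero_of_sq_eq hu' (c := c) (fun x => by simpa using hp2 (-x))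
      (neg_le_neg h) (by simpa using ha)

/-- Angle variable for `p² = 4 (s + k) (s + b) (M - s)`, `s' = p`, as long as `s + k > 0`. -/
lemma exists_angle {s p : ℝ → ℝ} {k b M : ℝ} (hs : ∀ x, HasDerivAt s (p x) x)
    (hp : ∀ x, HasDerivAt p (2 * ((s x + b) * (M - s x) + (s x + k) * (M - s x)
      - (s x + k) * (s x + b))) x)
    (hp2 : ∀ x, p x ^ 2 = 4 * (s x + k) * (s x + b) * (M - s x))
    (hq : ∀ x, 0 < s x + k) (hs0 : s 0 = 0) (hp0 : 0 < p 0) :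
    ∃ (r φ : ℝ) (θ : ℝ → ℝ), 0 < r ∧ -(Real.pi / 2) < φ ∧ φ < Real.pi / 2 ∧ θ 0 = φ ∧
      (∀ x, HasDerivAt θ (2 * √(s x + k)) x) ∧
      (∀ x, s x = r * (Real.sin (θ x) - Real.sin φ)) ∧
      (∀ x, p x = 2 * √(s x + k) * (r * Real.cos (θ x))) := by
  have hcont : Continuous s := continuous_iff_continuousAt.2 fun x => (hs x).continuousAt
  set Q : ℝ → ℝ := fun x => √(s x + k) with hQ
  have hQpos : ∀ x, 0 < Q x := fun x => Real.sqrt_pos.2 (hq x)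
  have hQ2 : ∀ x, Q x ^ 2 = s x + k := fun x => Real.sq_sqrt (hq x).le
  have hQc : Continuous Q := by fun_prop
  have hQd : ∀ x, HasDerivAt Q (p x / (2 * Q x)) x := fun x =>
    ((hs x).add_const k).sqrt (hq x).ne'
  set X : ℝ → ℝ := fun x => s x - (M - b) / 2 with hX
  set Y : ℝ → ℝ := fun x => p x / (2 * Q x) with hY
  have hXd : ∀ x, HasDerivAt X (2 * Q x * Y x) x := by
    intro x
    have h := (hs x).sub_const ((M - b) / 2)
    refine h.congr_deriv ?_
    have := (hQpos x).ne'
    simp only [hY]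
    field_simp
  have hYd : ∀ x, HasDerivAt Y (-(2 * Q x * X x)) x := by
    intro x
    have hne := (hQpos x).ne'
    have h := (hp x).div ((hQd x).const_mul 2) (by positivity)
    refine h.congr_deriv ?_
    have h1 := hp2 x
    rw [← hQ2 x] at h1 ⊢
    simp only [hX]
    field_simp
    linear_combination -h1
  set φ := Real.arctan (X 0 / Y 0) with hφ
  have hY0 : 0 < Y 0 := div_pos hp0 (mul_pos two_pos (hQpos 0))
  have hφc : 0 < Real.cos φ := Real.cos_arctan_pos _
  have htan : Real.sin φ / Real.cos φ = X 0 / Y 0 := by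
    rw [← Real.tan_eq_sin_div_cos, hφ, Real.tan_arctan]
  set r := Y 0 / Real.cos φ with hr
  have hrc : r * Real.cos φ = Y 0 := by rw [hr]; field_simp
  have hrs : r * Real.sin φ = X 0 := by
    rw [hr]
    field_simp at htan ⊢
    linarith
  set θ : ℝ → ℝ := fun x => φ + ∫ t in (0 : ℝ)..x, 2 * Q t with hθ
  have hθd : ∀ x, HasDerivAt θ (2 * Q x) x := by
    intro x
    exact ((continuous_const.mul hQc).integral_hasStrictDerivAt 0 x).hasDerivAt.const_add φ
  have hθ0 : θ 0 = φ := by simp [hθ]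
  have h1 : ∀ x, X x * Real.cos (θ x) - Y x * Real.sin (θ x) = 0 := by
    intro x
    rw [eq_of_hasDerivAt_zero (f := fun x => X x * Real.cos (θ x) - Y x * Real.sin (θ x))
      (fun x => ?_) x 0]
    · simp only [hθ0]
      rw [← hrc, ← hrs]
      ring
    · refine (((hXd x).mul (hθd x).cos).sub ((hYd x).mul (hθd x).sin)).congr_deriv ?_
      ring
  have h2 : ∀ x, X x * Real.sin (θ x) + Y x * Real.cos (θ x) = r := by
    intro x
    rw [eq_of_hasDerivAt_zero (f := fun x => X x * Real.sin (θ x) + Y x * Real.cos (θ x))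
      (fun x => ?_) x 0]
    · simp only [hθ0]
      rw [← hrc, ← hrs]
      linear_combination r * Real.sin_sq_add_cos_sq φ
    · refine (((hXd x).mul (hθd x).sin).add ((hYd x).mul (hθd x).cos)).congr_deriv ?_
      ring
  refine ⟨r, φ, θ, div_pos hY0 hφc, Real.neg_pi_div_two_lt_arctan _,
    Real.arctan_lt_pi_div_two _, hθ0, hθd, fun x => ?_, fun x => ?_⟩
  · have h3 : X x = r * Real.sin (θ x) := by
      linear_combination Real.cos (θ x) * h1 x + Real.sin (θ x) * h2 x
        - X x * Real.sin_sq_add_cos_sq (θ x)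
    have h4 : s x = X x - X 0 := by simp [hX, hs0]
    rw [h4, h3, ← hrs]
    ring
  · have h3 : Y x = r * Real.cos (θ x) := by
      linear_combination Real.cos (θ x) * h2 x - Real.sin (θ x) * h1 x
        - Y x * Real.sin_sq_add_cos_sq (θ x)
    rw [← h3]
    have := (hQpos x).ne'
    change p x = 2 * Q x * (p x / (2 * Q x))
    field_simp

end CubicOscillator

/-- Lemma 4.1 (zeros and signs of `α` and `β`): for the solution of
`α'' = δα − 2α²β`, `β'' = δβ − 2αβ²` with `δ = (η²τ² − τ² − 1)/4`, `α(0) = 0`,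
`β(0) = 2`, `α'(0) = ητ²/8`, `β'(0) = (η²τ² + η² − 1)/(2η)`. -/
theorem zeros_of_alpha_beta
    (η τ : ℝ) (hη : 0 < η) (hτ0 : 0 < τ) (hτ1 : τ ≤ 1)
    (δ : ℝ) (hδ : δ = (η ^ 2 * τ ^ 2 - τ ^ 2 - 1) / 4)
    (α β α' β' : ℝ → ℝ)
    (hα' : ∀ x, HasDerivAt α (α' x) x)
    (hβ' : ∀ x, HasDerivAt β (β' x) x)
    (hα'' : ∀ x, HasDerivAt α' (δ * α x - 2 * (α x) ^ 2 * β x) x)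
    (hβ'' : ∀ x, HasDerivAt β' (δ * β x - 2 * α x * (β x) ^ 2) x)
    (hα0 : α 0 = 0) (hβ0 : β 0 = 2)
    (hα'0 : α' 0 = η * τ ^ 2 / 8)
    (hβ'0 : β' 0 = (η ^ 2 * τ ^ 2 + η ^ 2 - 1) / (2 * η)) :
    (τ < 1 →
      ∃ xam xbm xbp xap : ℝ,
        xam < xbm ∧ xbm < 0 ∧ 0 < xbp ∧ xbp < xap ∧
        α xam = 0 ∧ α xap = 0 ∧
        (∀ x ∈ Ioo xam (0 : ℝ), α x < 0) ∧
        (∀ x ∈ Ioo (0 : ℝ) xap, 0 < α x) ∧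
        β xbm = 0 ∧ β xbp = 0 ∧
        (∀ x ∈ Ioo xam xbm, β x < 0) ∧
        (∀ x ∈ Ioo xbp xap, β x < 0) ∧
        (∀ x ∈ Ioo xbm xbp, 0 < β x)) ∧
    (τ = 1 →
      (∀ x < (0 : ℝ), α x < 0) ∧
      (∀ x, 0 < x → 0 < α x) ∧
      ∃ xbp : ℝ, 0 < xbp ∧ β xbp = 0 ∧
        (∀ x < xbp, 0 < β x) ∧ (∀ x, xbp < x → β x < 0)) := by
  have hαc : Continuous α := continuous_iff_continuousAt.2 fun x => (hα' x).continuousAt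
  have hβc : Continuous β := continuous_iff_continuousAt.2 fun x => (hβ' x).continuousAt
  have hL : ∀ x, α x * β' x - α' x * β x = -(η * τ ^ 2 / 4) := by
    intro x
    rw [eq_of_hasDerivAt_zero (f := fun x => α x * β' x - α' x * β x) (fun x => ?_) x 0]
    · simp only [hα0, hβ0, hα'0]
      ring
    · refine (((hα' x).mul (hβ'' x)).sub ((hα'' x).mul (hβ' x))).congr_deriv ?_
      ring
  have hE : ∀ x, α' x * β' x - δ * (α x * β x) + (α x * β x) ^ 2
      = τ ^ 2 * (η ^ 2 * τ ^ 2 + η ^ 2 - 1) / 16 := by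
    intro x
    rw [eq_of_hasDerivAt_zero
      (f := fun x => α' x * β' x - δ * (α x * β x) + (α x * β x) ^ 2) (fun x => ?_) x 0]
    · simp only [hα0, hα'0, hβ'0]
      field_simp
      ring
    · refine ((((hα'' x).mul (hβ'' x)).sub (((hα' x).mul (hβ' x)).const_mul δ)).add
        (((hα' x).mul (hβ' x)).pow 2)).congr_deriv ?_
      simp
      ring
  set s : ℝ → ℝ := fun x => α x * β x with hsdef
  set p : ℝ → ℝ := fun x => α' x * β x + α x * β' x with hpdef
  set M := η ^ 2 * τ ^ 2 / 4 with hM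
  have hMpos : 0 < M := by positivity
  have hs : ∀ x, HasDerivAt s (p x) x := fun x => (hα' x).mul (hβ' x)
  have hsc : Continuous s := hαc.mul hβc
  have hp : ∀ x, HasDerivAt p (2 * ((s x + τ ^ 2 / 4) * (M - s x) + (s x + 1 / 4) * (M - s x)
      - (s x + 1 / 4) * (s x + τ ^ 2 / 4))) x := by
    intro x
    refine (((hα'' x).mul (hβ' x)).add ((hα' x).mul (hβ'' x))).congr_deriv ?_
    simp only [hsdef, hM]
    have := hE x
    rw [hδ] at this ⊢
    linear_combination (2 : ℝ) * this
  have hp2 : ∀ x, p x ^ 2 = 4 * (s x + 1 / 4) * (s x + τ ^ 2 / 4) * (M - s x) := by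
    intro x
    have h1 := hE x
    have h2 := hL x
    simp only [hsdef, hpdef, hM]
    rw [hδ] at h1
    linear_combination (4 * (α x * β x)) * h1
      + (α x * β' x - α' x * β x - η * τ ^ 2 / 4) * h2
  have hs0 : s 0 = 0 := by simp [hsdef, hα0]
  have hp0 : 0 < p 0 := by
    simp only [hpdef, hα0, hα'0, hβ0]
    have : 0 < η * τ ^ 2 := by positivity
    linarith
  have hq : ∀ x, 0 < s x + 1 / 4 := by
    rcases hτ1.lt_or_eq with h | h
    · intro x
      have := neg_le_of_sq_eq_cubic (k := 1 / 4) hMpos (by positivity : 0 < τ ^ 2 / 4)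
        (by nlinarith) hsc hp2 hs0 x
      nlinarith
    · have hne := ne_zero_of_sq_eq' (u := fun x => s x + 1 / 4) (c := M + 1 / 4) (a := 0)
        (fun x => (hs x).add_const _) (fun x => by rw [hp2, h]; ring) (by norm_num [hs0])
      intro x
      exact pos_of_ne_zero_of_isPreconnected isPreconnected_univ (by fun_prop)
        (fun y _ => hne y) (mem_univ 0) (by norm_num [hs0]) x (mem_univ x)
  obtain ⟨r, φ, θ, hr, hφ1, hφ2, hθ0, hθd, hsθ, hpθ⟩ := exists_angle hs hp hp2 hq hs0 hp0
  have hθc : Continuous θ := continuous_iff_continuousAt.2 fun x => (hθd x).continuousAt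
  have hQ : ∀ x, 0 < 2 * √(s x + 1 / 4) := fun x => mul_pos two_pos (Real.sqrt_pos.2 (hq x))
  have hmono : StrictMono θ := strictMono_of_deriv_pos fun x => by
    rw [(hθd x).deriv]
    exact hQ x
  have hcosφ : 0 < Real.cos φ := Real.cos_pos_of_mem_Ioo ⟨hφ1, hφ2⟩
  have hLpos : 0 < η * τ ^ 2 / 4 := by positivity
  have hα_zero : ∀ x, s x = 0 → 0 < Real.cos (θ x) → α x = 0 := by
    intro x h hc
    refine (mul_eq_zero.1 h).resolve_right fun hβx => ?_
    have h1 := hpθ x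
    have h2 : 0 < 2 * √(s x + 1 / 4) * (r * Real.cos (θ x)) := mul_pos (hQ x) (mul_pos hr hc)
    have h3 := hL x
    simp only [hpdef, hβx] at h1 h3
    linarith
  have hβ_zero : ∀ x, s x = 0 → Real.cos (θ x) < 0 → β x = 0 := by
    intro x h hc
    refine (mul_eq_zero.1 h).resolve_left fun hαx => ?_
    have h1 := hpθ x
    have h2 : 2 * √(s x + 1 / 4) * (r * Real.cos (θ x)) < 0 :=
      mul_neg_of_pos_of_neg (hQ x) (mul_neg_of_pos_of_neg hr hc)
    have h3 := hL x
    simp only [hpdef, hαx] at h1 h3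
    linarith
  have hαβ : ∀ x, β x = 0 → α x ≠ 0 := by
    intro x h h'
    have := hL x
    rw [h, h'] at this
    linarith
  have hs_pos : ∀ x, Real.sin φ < Real.sin (θ x) → 0 < α x * β x := by
    intro x h
    have := hsθ x
    simp only [hsdef] at this
    rw [this]
    exact mul_pos hr (sub_pos.2 h)
  have hs_neg : ∀ x, Real.sin (θ x) < Real.sin φ → α x * β x < 0 := by
    intro x h
    have := hsθ x
    simp only [hsdef] at this
    rw [this]
    exact mul_neg_of_pos_of_neg hr (sub_neg.2 h)
  have hs1 : ∀ x, φ < θ x → θ x < Real.pi - φ → 0 < α x * β x := fun x h1 h2 =>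
    hs_pos x (sin_lt_sin_of_mem_Ioo h1 h2 hφ1)
  have hs2 : ∀ x, Real.pi - φ < θ x → θ x < 2 * Real.pi + φ → α x * β x < 0 := fun x h1 h2 =>
    hs_neg x (sin_lt_sin_of_pi_sub_lt h1 h2 hφ2)
  have hs3 : ∀ x, -Real.pi - φ < θ x → θ x < φ → α x * β x < 0 := fun x h1 h2 =>
    hs_neg x (by
      rw [← Real.sin_add_two_pi (θ x)]
      exact sin_lt_sin_of_pi_sub_lt (by linarith) (by linarith) hφ2)
  have hs4 : ∀ x, φ - 2 * Real.pi < θ x → θ x < -Real.pi - φ → 0 < α x * β x := fun x h1 h2 =>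
    hs_pos x (by
      rw [← Real.sin_add_two_pi (θ x)]
      exact sin_lt_sin_of_mem_Ioo (by linarith) (by linarith) hφ1)
  have hpi := Real.pi_pos
  have hβxbp : ∀ x, θ x = Real.pi - φ → β x = 0 := by
    intro x h
    refine hβ_zero x ?_ ?_
    · rw [hsθ, h, Real.sin_pi_sub, sub_self, mul_zero]
    · rw [h, Real.cos_pi_sub]
      linarith
  constructor
  · intro hτ
    have hsurj : Function.Surjective θ := by
      have hc : 0 < 1 / 4 - τ ^ 2 / 4 := by nlinarith
      refine surjective_of_le_hasDerivAt (c := 2 * √(1 / 4 - τ ^ 2 / 4))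
        (mul_pos two_pos (Real.sqrt_pos.2 hc)) hθd fun x => ?_
      have := neg_le_of_sq_eq_cubic (k := 1 / 4) hMpos (by positivity : 0 < τ ^ 2 / 4)
        (by linarith) hsc hp2 hs0 x
      gcongr
      linarith
    obtain ⟨xbp, hxbp⟩ := hsurj (Real.pi - φ)
    obtain ⟨xap, hxap⟩ := hsurj (2 * Real.pi + φ)
    obtain ⟨xbm, hxbm⟩ := hsurj (-Real.pi - φ)
    obtain ⟨xam, hxam⟩ := hsurj (φ - 2 * Real.pi)
    have h1 : xam < xbm := hmono.lt_iff_lt.1 (by linarith)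
    have h2 : xbm < 0 := hmono.lt_iff_lt.1 (by linarith)
    have h3 : 0 < xbp := hmono.lt_iff_lt.1 (by linarith)
    have h4 : xbp < xap := hmono.lt_iff_lt.1 (by linarith)
    have hβbp := hβxbp xbp hxbp
    have hβbm : β xbm = 0 := by
      have hcos : Real.cos (θ xbm) = -Real.cos φ := by
        rw [hxbm, ← Real.cos_add_two_pi, ← Real.cos_pi_sub]
        congr 1
        ring
      have hsin : Real.sin (θ xbm) = Real.sin φ := by
        rw [hxbm, ← Real.sin_add_two_pi, ← Real.sin_pi_sub φ]
        congr 1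
        ring
      exact hβ_zero _ (by rw [hsθ, hsin, sub_self, mul_zero]) (by linarith)
    have hα_of : ∀ x, Real.sin (θ x) = Real.sin φ → Real.cos (θ x) = Real.cos φ → α x = 0 :=
      fun x h h' => hα_zero x (by rw [hsθ, h, sub_self, mul_zero]) (by rwa [h'])
    have hαap : α xap = 0 := hα_of _
      (by rw [hxap, add_comm, Real.sin_add_two_pi]) (by rw [hxap, add_comm, Real.cos_add_two_pi])
    have hαam : α xam = 0 := hα_of _
      (by rw [hxam, Real.sin_sub_two_pi]) (by rw [hxam, Real.cos_sub_two_pi])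
    have sgn1 : ∀ x, 0 < x → x < xbp → 0 < α x * β x := fun x hx hx' =>
      hs1 x (hθ0 ▸ hmono hx) (hxbp ▸ hmono hx')
    have sgn2 : ∀ x, xbp < x → x < xap → α x * β x < 0 := fun x hx hx' =>
      hs2 x (hxbp ▸ hmono hx) (hxap ▸ hmono hx')
    have sgn3 : ∀ x, xbm < x → x < 0 → α x * β x < 0 := fun x hx hx' =>
      hs3 x (hxbm ▸ hmono hx) (hθ0 ▸ hmono hx')
    have sgn4 : ∀ x, xam < x → x < xbm → 0 < α x * β x := fun x hx hx' =>
      hs4 x (hxam ▸ hmono hx) (hxbm ▸ hmono hx')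
    have hβpos : ∀ x ∈ Ioo xbm xbp, 0 < β x := by
      refine pos_of_ne_zero_of_isPreconnected isPreconnected_Ioo hβc (fun x hx => ?_)
        (show (0 : ℝ) ∈ Ioo xbm xbp from ⟨h2, h3⟩) (by norm_num [hβ0])
      rcases lt_trichotomy x 0 with h | h | h
      · exact right_ne_zero_of_mul (sgn3 x hx.1 h).ne
      · norm_num [h, hβ0]
      · exact right_ne_zero_of_mul (sgn1 x h hx.2).ne'
    have hαneg : ∀ x ∈ Ioo xam 0, α x < 0 := by
      refine neg_of_ne_zero_of_isPreconnected isPreconnected_Ioo hαc (fun x hx => ?_)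
        (show xbm / 2 ∈ Ioo xam 0 from ⟨by linarith, by linarith⟩)
        (neg_of_mul_neg_left (sgn3 (xbm / 2) (by linarith) (by linarith))
          (hβpos _ ⟨by linarith, by linarith⟩).le)
      rcases lt_trichotomy x xbm with h | h | h
      · exact left_ne_zero_of_mul (sgn4 x hx.1 h).ne'
      · exact hαβ x (h ▸ hβbm)
      · exact left_ne_zero_of_mul (sgn3 x h hx.2).ne
    have hαpos : ∀ x ∈ Ioo 0 xap, 0 < α x := by
      refine pos_of_ne_zero_of_isPreconnected isPreconnected_Ioo hαc (fun x hx => ?_)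
        (show xbp / 2 ∈ Ioo 0 xap from ⟨by linarith, by linarith⟩)
        (pos_of_mul_pos_left (sgn1 (xbp / 2) (by linarith) (by linarith))
          (hβpos _ ⟨by linarith, by linarith⟩).le)
      rcases lt_trichotomy x xbp with h | h | h
      · exact left_ne_zero_of_mul (sgn1 x hx.1 h).ne'
      · exact hαβ x (h ▸ hβbp)
      · exact left_ne_zero_of_mul (sgn2 x h hx.2).ne
    refine ⟨xam, xbm, xbp, xap, h1, h2, h3, h4, hαam, hαap, hαneg, hαpos, hβbm, hβbp,
      fun x hx => ?_, fun x hx => ?_, hβpos⟩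
    · exact neg_of_mul_pos_right (sgn4 x hx.1 hx.2) (hαneg x ⟨hx.1, hx.2.trans h2⟩).le
    · exact neg_of_mul_neg_right (sgn2 x hx.1 hx.2) (hαpos x ⟨h3.trans hx.1, hx.2⟩).le
  · intro hτ
    have hsinφ : -1 < Real.sin φ := by
      have := Real.sin_lt_sin_of_lt_of_le_pi_div_two (x := -(Real.pi / 2)) le_rfl hφ2.le hφ1
      simpa using this
    have hsin_ne : ∀ x, Real.sin (θ x) ≠ -1 := by
      intro x h
      have hc : Real.cos (θ x) = 0 := by
        have := Real.sin_sq_add_cos_sq (θ x)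
        rw [h] at this
        nlinarith
      have hp1 := hp2 x
      rw [hpθ x, hc, hτ] at hp1
      have hneg : s x < 0 := by
        rw [hsθ, h]
        exact mul_neg_of_pos_of_neg hr (by linarith)
      norm_num at hp1
      rcases hp1 with h' | h' <;> linarith [hq x]
    have hlow : ∀ x, -(Real.pi / 2) < θ x := by
      intro x
      by_contra! h
      obtain ⟨y, hy⟩ := mem_range_of_exists_le_of_exists_ge hθc ⟨x, h⟩
        ⟨0, by rw [hθ0]; exact hφ1.le⟩
      exact hsin_ne y (by rw [hy]; simp)
    have hupp : ∀ x, θ x < 3 * Real.pi / 2 := by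
      intro x
      by_contra! h
      obtain ⟨y, hy⟩ := mem_range_of_exists_le_of_exists_ge hθc
        ⟨0, by rw [hθ0]; linarith⟩ ⟨x, h⟩
      refine hsin_ne y ?_
      rw [hy, show 3 * Real.pi / 2 = Real.pi / 2 + Real.pi by ring, Real.sin_add_pi]
      simp
    obtain ⟨xbp, hxbp⟩ : ∃ x, θ x = Real.pi - φ := by
      by_contra! hne
      have hlt : ∀ x, θ x < Real.pi - φ := by
        intro x
        by_contra! h
        obtain ⟨y, hy⟩ := mem_range_of_exists_le_of_exists_ge hθc
          ⟨0, by rw [hθ0]; linarith⟩ ⟨x, h⟩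
        exact hne y hy
      have h := mul_sub_le_sub_of_hasDerivAt (a := 0) (b := Real.pi - 2 * φ) (c := 1) hθd
        (by linarith) (fun x hx => by
          have hx' : 0 < s x := hs1 x (hθ0 ▸ hmono hx.1) (hlt x)
          have : 1 / 2 ≤ √(s x + 1 / 4) := Real.le_sqrt_of_sq_le (by linarith)
          linarith)
      have := hlt (Real.pi - 2 * φ)
      linarith
    have h3 : 0 < xbp := hmono.lt_iff_lt.1 (by linarith)
    have hβbp := hβxbp xbp hxbp
    have sgn1 : ∀ x, 0 < x → x < xbp → 0 < α x * β x := fun x hx hx' =>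
      hs1 x (hθ0 ▸ hmono hx) (hxbp ▸ hmono hx')
    have sgn2 : ∀ x, xbp < x → α x * β x < 0 := fun x hx =>
      hs2 x (hxbp ▸ hmono hx) (by linarith [hupp x])
    have sgn3 : ∀ x, x < 0 → α x * β x < 0 := fun x hx =>
      hs3 x (by linarith [hlow x]) (hθ0 ▸ hmono hx)
    have hβpos : ∀ x ∈ Iio xbp, 0 < β x := by
      refine pos_of_ne_zero_of_isPreconnected isPreconnected_Iio hβc (fun x hx => ?_)
        (show (0 : ℝ) ∈ Iio xbp from h3) (by norm_num [hβ0])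
      rcases lt_trichotomy x 0 with h | h | h
      · exact right_ne_zero_of_mul (sgn3 x h).ne
      · norm_num [h, hβ0]
      · exact right_ne_zero_of_mul (sgn1 x h hx).ne'
    have hαpos : ∀ x ∈ Ioi (0 : ℝ), 0 < α x := by
      refine pos_of_ne_zero_of_isPreconnected isPreconnected_Ioi hαc (fun x hx => ?_)
        (show xbp / 2 ∈ Ioi (0 : ℝ) from half_pos h3)
        (pos_of_mul_pos_left (sgn1 (xbp / 2) (by linarith) (by linarith))
          (hβpos _ (half_lt_self h3)).le)
      rcases lt_trichotomy x xbp with h | h | h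
      · exact left_ne_zero_of_mul (sgn1 x hx h).ne'
      · exact hαβ x (h ▸ hβbp)
      · exact left_ne_zero_of_mul (sgn2 x h).ne
    exact ⟨fun x hx => neg_of_mul_neg_left (sgn3 x hx) (hβpos x (hx.trans h3)).le, hαpos,
      xbp, h3, hβbp, hβpos, fun x hx =>
        neg_of_mul_neg_right (sgn2 x hx) (hαpos x (h3.trans hx)).le⟩
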